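/- (Proposition 4.3, alternative derivation of the Bjerksund–Stensland formula) Let a > 0, b ∈ ℝ, put κ = b·σ₂/σ₁ and σ = √(σ₁² + b²σ₂² - 2ρbσ₁σ₂). For arbitrary points x₀¹, x₀², x₀³ ∈ ℝ set δ₁ = z₀¹(bσ₂, a, x₀¹) - κ·x₀¹, δ₂ = z₀²(bσ₂, a, x₀²) - κ·x₀², δ₃ = z₀³(bσ₂, a, x₀³) - κ·x₀³. Then the δᵢ do not depend on the choice of the points x₀ⁱ, and -δ₁/√(1 + κ² - 2ρκ) = d̄₁, -δ₂/√(1 + κ² - 2ρκ) = d̄₂, -δ₃/√(1 + κ² - 2ρκ) = d̄₃, where d̄₁ = ( ln(F₁/a) + (σ₁²/2 + b²σ₂²/2 - bρσ₁σ₂)T )/(σ√T), d̄₂ = ( ln(F₁/a) + (-σ₁²/2 - bσ₂² + b²σ₂²/2 + ρσ₁σ₂)T )/(σ√T), d̄₃ = ( ln(F₁/a) + (-σ₁²/2 + b²σ₂²/2)T )/(σ√T). Consequently e^{-rT}[F₁Φ(-δ₁/√(1+κ²-2ρκ)) - F₂Φ(-δ₂/√(1+κ²-2ρκ)) - K·Φ(-δ₃/√(1+κ²-2ρκ))]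 equals the Bjerksund–Stensland price e^{-rT}[F₁Φ(d̄₁) - F₂Φ(d̄₂) - KΦ(d̄₃)]. -/

import Mathlib

open Real

/-- The standard normal cumulative distribution function Φ. -/
noncomputable def stdGaussianCDF (x : ℝ) : ℝ :=
  ((ProbabilityTheory.gaussianReal 0 1) (Set.Iic x)).toReal

theorem log_mul_exp_div {a F : ℝ} (ha : 0 < a) (hF : 0 < F) (y : ℝ) :
    Real.log (a * Real.exp y / F) = y - Real.log (F / a) := by
  rw [Real.log_div (by positivity) hF.ne', Real.log_mul ha.ne' (Real.exp_ne_zero y),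
    Real.log_exp, Real.log_div hF.ne' ha.ne']
  ring

/-- Subtracting the line of slope `b * σ₂ / σ₁` from the boundary function removes the dependence
on the point `x`. -/
theorem boundary_sub_slope_mul {a F T σ₁ : ℝ} (ha : 0 < a) (hF : 0 < F) (hT : 0 < T)
    (hσ₁ : 0 < σ₁) (b σ₂ c e x : ℝ) :
    1 / (σ₁ * Real.sqrt T) *
        Real.log (a * Real.exp (c * T + b * σ₂ * Real.sqrt T * x - (b * σ₂) ^ 2 * T / 2) / F)
      + e * Real.sqrt T - b * σ₂ / σ₁ * x
      = -((Real.log (F / a) + (b ^ 2 * σ₂ ^ 2 / 2 - c - e * σ₁) * T) / (σ₁ * Real.sqrt T)) := by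
  have hs : 0 < Real.sqrt T := Real.sqrt_pos.2 hT
  have hsq : Real.sqrt T ^ 2 = T := Real.sq_sqrt hT.le
  rw [log_mul_exp_div ha hF]
  generalize Real.sqrt T = s at hs hsq ⊢
  subst hsq
  field_simp
  ring

theorem sqrt_spread_variance {σ₁ : ℝ} (hσ₁ : 0 < σ₁) (ρ b σ₂ : ℝ) :
    Real.sqrt (σ₁ ^ 2 + b ^ 2 * σ₂ ^ 2 - 2 * ρ * b * σ₁ * σ₂) =
      σ₁ * Real.sqrt (1 + (b * σ₂ / σ₁) ^ 2 - 2 * ρ * (b * σ₂ / σ₁)) := by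
  rw [← Real.sqrt_sq hσ₁.le, ← Real.sqrt_mul (sq_nonneg _), Real.sqrt_sq hσ₁.le]
  congr 1
  field_simp

/-- (Proposition 4.3, alternative derivation of the Bjerksund–Stensland formula)
With `κ = bσ₂/σ₁` and `δᵢ = z₀ⁱ(bσ₂, a, x₀ⁱ) - κx₀ⁱ`, the `δᵢ` do not depend on the choice
of the points `x₀ⁱ`, one has `-δᵢ/√(1 + κ² - 2ρκ) = d̄ᵢ` for `i = 1,2,3`, and consequently
`e^{-rT}[F₁Φ(-δ₁/√(1+κ²-2ρκ)) - F₂Φ(-δ₂/√(1+κ²-2ρκ)) - KΦ(-δ₃/√(1+κ²-2ρκ))]`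
equals the Bjerksund–Stensland price `e^{-rT}[F₁Φ(d̄₁) - F₂Φ(d̄₂) - KΦ(d̄₃)]`. -/
theorem alternative_derivation_BS_formula
    (ρ T σ₁ σ₂ F₁ F₂ K r : ℝ)
    (hρ₁ : -1 < ρ) (hρ₂ : ρ < 1) (hT : 0 < T)
    (hσ₁ : 0 < σ₁) (hσ₂ : 0 < σ₂) (hF₁ : 0 < F₁) (hF₂ : 0 < F₂)
    (z₁ z₂ z₃ : ℝ → ℝ → ℝ → ℝ)
    (hz₁ : z₁ = fun q a h => (1 / (σ₁ * Real.sqrt T)) *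
      Real.log (a * Real.exp (ρ * σ₁ * q * T + q * Real.sqrt T * h - q ^ 2 * T / 2) / F₁)
      - σ₁ * Real.sqrt T / 2)
    (hz₂ : z₂ = fun q a h => (1 / (σ₁ * Real.sqrt T)) *
      Real.log (a * Real.exp (q * σ₂ * T + q * Real.sqrt T * h - q ^ 2 * T / 2) / F₁)
      + (σ₁ / 2 - ρ * σ₂) * Real.sqrt T)
    (hz₃ : z₃ = fun q a h => (1 / (σ₁ * Real.sqrt T)) *
      Real.log (a * Real.exp (q * Real.sqrt T * h - q ^ 2 * T / 2) / F₁)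
      + σ₁ * Real.sqrt T / 2)
    (a b : ℝ) (ha : 0 < a)
    (κ σ : ℝ) (hκ : κ = b * σ₂ / σ₁)
    (hσ : σ = Real.sqrt (σ₁ ^ 2 + b ^ 2 * σ₂ ^ 2 - 2 * ρ * b * σ₁ * σ₂))
    (d₁ d₂ d₃ : ℝ)
    (hd₁ : d₁ = (Real.log (F₁ / a)
      + (σ₁ ^ 2 / 2 + b ^ 2 * σ₂ ^ 2 / 2 - b * ρ * σ₁ * σ₂) * T) / (σ * Real.sqrt T))
    (hd₂ : d₂ = (Real.log (F₁ / a)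
      + (-σ₁ ^ 2 / 2 - b * σ₂ ^ 2 + b ^ 2 * σ₂ ^ 2 / 2 + ρ * σ₁ * σ₂) * T) / (σ * Real.sqrt T))
    (hd₃ : d₃ = (Real.log (F₁ / a)
      + (-σ₁ ^ 2 / 2 + b ^ 2 * σ₂ ^ 2 / 2) * T) / (σ * Real.sqrt T)) :
    (∀ x x' : ℝ, z₁ (b * σ₂) a x - κ * x = z₁ (b * σ₂) a x' - κ * x') ∧
    (∀ x x' : ℝ, z₂ (b * σ₂) a x - κ * x = z₂ (b * σ₂) a x' - κ * x') ∧
    (∀ x x' : ℝ, z₃ (b * σ₂) a x - κ * x = z₃ (b * σ₂) a x' - κ * x') ∧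
    (∀ x₀₁ x₀₂ x₀₃ : ℝ,
      -(z₁ (b * σ₂) a x₀₁ - κ * x₀₁) / Real.sqrt (1 + κ ^ 2 - 2 * ρ * κ) = d₁ ∧
      -(z₂ (b * σ₂) a x₀₂ - κ * x₀₂) / Real.sqrt (1 + κ ^ 2 - 2 * ρ * κ) = d₂ ∧
      -(z₃ (b * σ₂) a x₀₃ - κ * x₀₃) / Real.sqrt (1 + κ ^ 2 - 2 * ρ * κ) = d₃ ∧
      Real.exp (-(r * T)) *
        (F₁ * stdGaussianCDF (-(z₁ (b * σ₂) a x₀₁ - κ * x₀₁) / Real.sqrt (1 + κ ^ 2 - 2 * ρ * κ))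
        - F₂ * stdGaussianCDF (-(z₂ (b * σ₂) a x₀₂ - κ * x₀₂) / Real.sqrt (1 + κ ^ 2 - 2 * ρ * κ))
        - K * stdGaussianCDF (-(z₃ (b * σ₂) a x₀₃ - κ * x₀₃) / Real.sqrt (1 + κ ^ 2 - 2 * ρ * κ)))
      = Real.exp (-(r * T)) *
        (F₁ * stdGaussianCDF d₁ - F₂ * stdGaussianCDF d₂ - K * stdGaussianCDF d₃)) := by
  have e₁ : ∀ x, z₁ (b * σ₂) a x - κ * x = -((Real.log (F₁ / a)
      + (σ₁ ^ 2 / 2 + b ^ 2 * σ₂ ^ 2 / 2 - b * ρ * σ₁ * σ₂) * T) / (σ₁ * Real.sqrt T)) := by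
    intro x
    have h := boundary_sub_slope_mul ha hF₁ hT hσ₁ b σ₂ (ρ * σ₁ * (b * σ₂)) (-σ₁ / 2) x
    rw [hz₁, hκ]
    convert h using 1 <;> ring
  have e₂ : ∀ x, z₂ (b * σ₂) a x - κ * x = -((Real.log (F₁ / a)
      + (-σ₁ ^ 2 / 2 - b * σ₂ ^ 2 + b ^ 2 * σ₂ ^ 2 / 2 + ρ * σ₁ * σ₂) * T)
        / (σ₁ * Real.sqrt T)) := by
    intro x
    have h := boundary_sub_slope_mul ha hF₁ hT hσ₁ b σ₂ (b * σ₂ * σ₂) (σ₁ / 2 - ρ * σ₂) x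
    rw [hz₂, hκ]
    convert h using 1
    ring
  have e₃ : ∀ x, z₃ (b * σ₂) a x - κ * x = -((Real.log (F₁ / a)
      + (-σ₁ ^ 2 / 2 + b ^ 2 * σ₂ ^ 2 / 2) * T) / (σ₁ * Real.sqrt T)) := by
    intro x
    have h := boundary_sub_slope_mul ha hF₁ hT hσ₁ b σ₂ 0 (σ₁ / 2) x
    rw [zero_mul, zero_add] at h
    rw [hz₃, hκ]
    convert h using 1 <;> ring
  have hσκ : σ = σ₁ * Real.sqrt (1 + κ ^ 2 - 2 * ρ * κ) := by
    rw [hσ, hκ]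
    exact sqrt_spread_variance hσ₁ ρ b σ₂
  have hdiv : ∀ A : ℝ, -(-(A / (σ₁ * Real.sqrt T))) / Real.sqrt (1 + κ ^ 2 - 2 * ρ * κ)
      = A / (σ * Real.sqrt T) := by
    intro A
    rw [neg_neg, div_div, hσκ, mul_right_comm]
  refine ⟨fun x x' => by rw [e₁, e₁], fun x x' => by rw [e₂, e₂],
    fun x x' => by rw [e₃, e₃], fun x₁ x₂ x₃ => ?_⟩
  rw [e₁, e₂, e₃, hdiv, hdiv, hdiv, ← hd₁, ← hd₂, ← hd₃]
  exact ⟨rfl, rfl, rfl, rfl⟩
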